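/- Let k be an algebraically closed field of characteristic p > 0, let G be a normal subgroup of a finite group G̃, and let M be a finitely generated kG-module that is τ-rigid and satisfies xM ≅ M as kG-modules for every x ∈ G̃. Then the induced module Ind_G^{G̃} M is a τ-rigid kG̃-module. -/

import Mathlib

/-!
Common definitions: τ-tilting theory over a ring, blocks of group algebras,
conjugate modules and induced modules.

Since group algebras (and their blocks) are symmetric algebras, the
Auslander–Reiten translate is `τ = Ω²` computed via (minimal) projective covers;
τ-rigidity is formulated accordingly.  Support τ-tilting modules are formulated
via support τ-tilting pairs: `M` is support τ-tilting iff `M` is τ-rigid and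
there is a projective module `P` with `Hom(P, M) = 0` and `|M| + |P| = |Λ|`
(the number of simple modules), which is the standard equivalent
characterisation (Adachi–Iyama–Reiten, Prop. 2.3; Remark 2.2 of the paper).
-/

universe u

section GeneralDefs

variable (A : Type u) [Ring A]

/-- A module is indecomposable if it is nontrivial and has no nontrivial
direct sum decomposition. -/
def IsIndecModule (X : Type u) [AddCommGroup X] [Module A X] : Prop :=
  Nontrivial X ∧ ∀ U V : Submodule A X, IsCompl U V → U = ⊥ ∨ V = ⊥

/-- `|M|`: the number of isomorphism classes of indecomposable direct summands
of `M`. -/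
noncomputable def numIndec (M : Type u) [AddCommGroup M] [Module A M] : ℕ :=
  Nat.card (Quot fun
    (L L' : {L : Submodule A M // (∃ L'', IsCompl L L'') ∧ IsIndecModule A L}) =>
      Nonempty (L.1 ≃ₗ[A] L'.1))

/-- `|A|`: the number of isomorphism classes of simple `A`-modules. -/
noncomputable def numSimples : ℕ :=
  Nat.card (Quot fun (X Y : {X : ModuleCat.{u} A // IsSimpleModule A X}) =>
    Nonempty ((X.1 : Type u) ≃ₗ[A] (Y.1 : Type u)))

/-- The number of isomorphism classes of simple `A`-modules lying in the block
with block idempotent `b` (i.e. on which `b` acts as the identity). -/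
noncomputable def numSimplesIn (b : A) : ℕ :=
  Nat.card (Quot fun
    (X Y : {X : ModuleCat.{u} A //
        IsSimpleModule A X ∧ ∀ v : (X : Type u), b • v = v}) =>
      Nonempty ((X.1 : Type u) ≃ₗ[A] (Y.1 : Type u)))

/-- `π : P → M` is a projective cover: `P` is projective, `π` is surjective and
`ker π` is superfluous (i.e. `π` is an essential epimorphism). -/
def IsProjCover {P M : Type u} [AddCommGroup P] [Module A P]
    [AddCommGroup M] [Module A M] (π : P →ₗ[A] M) : Prop :=
  Module.Projective A P ∧ Function.Surjective π ∧
    ∀ N : Submodule A P, N ⊔ LinearMap.ker π = ⊤ → N = ⊤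

/-- `M` is τ-rigid: `Hom(M, τ M) = 0`, where for the symmetric algebras
considered here `τ M = Ω² M` is computed from minimal projective presentations:
for (any) projective cover `π₀ : P₀ → M` and projective cover
`π₁ : P₁ → ker π₀`, one has `τ M = ker π₁`. -/
def IsTauRigid (M : Type u) [AddCommGroup M] [Module A M] : Prop :=
  ∀ (P₀ : Type u) [AddCommGroup P₀] [Module A P₀] (π₀ : P₀ →ₗ[A] M),
    IsProjCover A π₀ →
    ∀ (P₁ : Type u) [AddCommGroup P₁] [Module A P₁]
      (π₁ : P₁ →ₗ[A] ↥(LinearMap.ker π₀)),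
      IsProjCover A π₁ →
      ∀ g : M →ₗ[A] ↥(LinearMap.ker π₁), g = 0

/-- `M` is a support τ-tilting `A`-module (via support τ-tilting pairs):
`M` is τ-rigid and there is a (finitely generated) projective `A`-module `P`
with `Hom_A(P, M) = 0` and `|M| + |P| = |A|`. -/
def IsSupportTauTilting (M : Type u) [AddCommGroup M] [Module A M] : Prop :=
  IsTauRigid A M ∧
  ∃ P : ModuleCat.{u} A, Module.Projective A P ∧ Module.Finite A P ∧
    (∀ f : (P : Type u) →ₗ[A] M, f = 0) ∧
    numIndec A M + numIndec A (P : Type u) = numSimples A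

/-- `b` is a block idempotent: a primitive central idempotent of `A`.
The corresponding block is `B = A * b`. -/
def IsBlockIdem (b : A) : Prop :=
  b ≠ 0 ∧ b * b = b ∧ (∀ r : A, b * r = r * b) ∧
  ∀ c : A, c * c = c → (∀ r : A, c * r = r * c) → b * c = c → c = 0 ∨ c = b

/-- `M` is a support τ-tilting module over the block `B` with block idempotent
`b`: `M` lies in `B`, is τ-rigid (over `B`, equivalently over `A`) and there is
a projective module `P` lying in `B` with `Hom(P, M) = 0` and
`|M| + |P| = |B|`. -/
def IsSupportTauTiltingBlock (b : A) (M : Type u) [AddCommGroup M]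
    [Module A M] : Prop :=
  (∀ m : M, b • m = m) ∧ IsTauRigid A M ∧
  ∃ P : ModuleCat.{u} A, Module.Projective A P ∧ Module.Finite A P ∧
    (∀ v : (P : Type u), b • v = v) ∧
    (∀ f : (P : Type u) →ₗ[A] M, f = 0) ∧
    numIndec A M + numIndec A (P : Type u) = numSimplesIn A b

/-- The partial order on support τ-tilting modules: `M ≥ M'` iff there are
`r > 0` and an epimorphism `M^{⊕ r} ↠ M'`. -/
def stGE (M M' : Type u) [AddCommGroup M] [Module A M]
    [AddCommGroup M'] [Module A M'] : Prop :=
  ∃ r : ℕ, 0 < r ∧ ∃ φ : (Fin r → M) →ₗ[A] M', Function.Surjective φ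

/-- `X ∈ add M`: `X` is a direct summand of a finite direct sum of copies
of `M`. -/
def InAdd (M X : Type u) [AddCommGroup M] [Module A M]
    [AddCommGroup X] [Module A X] : Prop :=
  ∃ (n : ℕ) (i : X →ₗ[A] (Fin n → M)) (p : (Fin n → M) →ₗ[A] X),
    p.comp i = LinearMap.id

/-- For a central idempotent `b` of `A`, the direct summand `b • N` of an
`A`-module `N`, realised as the submodule of elements on which `b` acts as the
identity. -/
def blockComponent (b : A) (hb : ∀ r : A, b * r = r * b)
    (N : Type u) [AddCommGroup N] [Module A N] : Submodule A N where
  carrier := {n | b • n = n}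
  add_mem' := by
    intro a c ha hc
    simp only [Set.mem_setOf_eq, smul_add] at *
    rw [ha, hc]
  zero_mem' := by simp
  smul_mem' := by
    intro r n hn
    simp only [Set.mem_setOf_eq] at *
    rw [← mul_smul, hb, mul_smul, hn]

end GeneralDefs

section InducedDefs

/-- `(N, j)` is the module induced from `M` along the ring homomorphism
`ι : R →+* S`, i.e. `N ≅ S ⊗_R M`, characterised by the universal property of
extension of scalars: `j : M → N` is `R`-linear (with `R` acting on `N` via
`ι`) and every `R`-linear map from `M` to (the restriction of) an `S`-module
`X` factors uniquely through an `S`-linear map `N → X`. -/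
def IsInducedMod {R S : Type u} [Ring R] [Ring S] (ι : R →+* S)
    (M : Type u) [AddCommGroup M] [Module R M]
    (N : Type u) [AddCommGroup N] [Module S N] (j : M →+ N) : Prop :=
  (∀ (r : R) (m : M), j (r • m) = ι r • j m) ∧
  ∀ (X : Type u) [AddCommGroup X] [Module S X] (f : M →+ X),
    (∀ (r : R) (m : M), f (r • m) = ι r • f m) →
    ∃! g : N →ₗ[S] X, ∀ m : M, g (j m) = f m

end InducedDefs

section GroupDefs

variable (k : Type u) [Field k] (Gt : Type u) [Group Gt] (G : Subgroup Gt)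
  [G.Normal]

/-- The ring automorphism of `kG` induced by conjugation by `x ∈ G̃` on the
normal subgroup `G`. -/
noncomputable def conjRingHom (x : Gt) :
    MonoidAlgebra k ↥G →+* MonoidAlgebra k ↥G :=
  MonoidAlgebra.mapDomainRingHom k (MulAut.conjNormal (H := G) x)

/-- The ring homomorphism `kG →+* kG̃` induced by the inclusion `G ≤ G̃`. -/
noncomputable def inclRingHom : MonoidAlgebra k ↥G →+* MonoidAlgebra k Gt :=
  MonoidAlgebra.mapDomainRingHom k G.subtype

/-- `x M ≅ M`: the conjugate module `x M` (with `g` acting as `x⁻¹ g x` does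
on `M`) is isomorphic to `M`; equivalently, there is an additive automorphism
of `M` which is semilinear for the conjugation automorphism of `kG`. -/
def IsConjStable (x : Gt) (M : Type u) [AddCommGroup M]
    [Module (MonoidAlgebra k ↥G) M] : Prop :=
  ∃ φ : M ≃+ M, ∀ (r : MonoidAlgebra k ↥G) (m : M),
    φ (conjRingHom k Gt G x r • m) = r • φ m

end GroupDefs

section ProjectiveCovers

variable {A : Type u} [Ring A]

lemma IsProjCover.surjective_of_comp {P M X : Type u} [AddCommGroup P] [Module A P]
    [AddCommGroup M] [Module A M] [AddCommGroup X] [Module A X] {π : P →ₗ[A] M}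
    (hπ : IsProjCover A π) (f : X →ₗ[A] P) (hf : Function.Surjective (π ∘ₗ f)) :
    Function.Surjective f := by
  rw [← LinearMap.range_eq_top]
  refine hπ.2.2 _ (eq_top_iff.2 fun p _ => ?_)
  obtain ⟨x, hx⟩ := hf (π p)
  rw [← add_sub_cancel (f x) p]
  refine Submodule.add_mem_sup ⟨x, rfl⟩ ?_
  rw [LinearMap.mem_ker, map_sub, sub_eq_zero]
  exact hx.symm

lemma IsProjCover.injective_of_comp_eq {P M : Type u} [AddCommGroup P] [Module A P]
    [AddCommGroup M] [Module A M] {π : P →ₗ[A] M} (hπ : IsProjCover A π)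
    (e : P →ₗ[A] P) (he : π ∘ₗ e = π) : Function.Injective e := by
  have := hπ.1
  have he_surj : Function.Surjective e := hπ.surjective_of_comp e (by rw [he]; exact hπ.2.1)
  obtain ⟨s, hs⟩ := Module.projective_lifting_property e LinearMap.id he_surj
  have hs_surj : Function.Surjective s := by
    refine hπ.surjective_of_comp s ?_
    rw [← he, LinearMap.comp_assoc, hs, LinearMap.comp_id]
    exact hπ.2.1
  have hs' : ∀ x, e (s x) = x := fun x => LinearMap.congr_fun hs x
  intro x y hxy
  obtain ⟨x, rfl⟩ := hs_surj x
  obtain ⟨y, rfl⟩ := hs_surj y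
  rw [hs', hs'] at hxy
  rw [hxy]

/-- τ-rigidity can be tested on an arbitrary projective presentation, provided the kernel of
that presentation receives no nonzero maps. -/
lemma isTauRigid_of_presentation {N Q₀ Q₁ : Type u} [AddCommGroup N] [Module A N]
    [AddCommGroup Q₀] [Module A Q₀] [AddCommGroup Q₁] [Module A Q₁]
    [Module.Projective A Q₀] [Module.Projective A Q₁]
    (q₁ : Q₁ →ₗ[A] Q₀) (q₀ : Q₀ →ₗ[A] N) (h₀ : Function.Surjective q₀)
    (hex : Function.Exact q₁ q₀)
    (hom : ∀ g : N →ₗ[A] Q₁, q₁ ∘ₗ g = 0 → g = 0) : IsTauRigid A N := by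
  intro P₀ _ _ π₀ hπ₀ P₁ _ _ π₁ hπ₁ g
  have := hπ₀.1
  have := hπ₁.1
  obtain ⟨b, hb⟩ := Module.projective_lifting_property π₀ q₀ hπ₀.2.1
  have hb_surj : Function.Surjective b := hπ₀.surjective_of_comp b (by rwa [hb])
  obtain ⟨a, ha⟩ := Module.projective_lifting_property b LinearMap.id hb_surj
  have hb' : ∀ x, π₀ (b x) = q₀ x := fun x => LinearMap.congr_fun hb x
  have ha' : ∀ x, b (a x) = x := fun x => LinearMap.congr_fun ha x
  let aK : LinearMap.ker π₀ →ₗ[A] LinearMap.ker q₀ := a.restrict fun x hx => by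
    rw [LinearMap.mem_ker, ← hb', ha', hx]
  let bK : LinearMap.ker q₀ →ₗ[A] LinearMap.ker π₀ := b.restrict fun x hx => by
    rw [LinearMap.mem_ker, hb', hx]
  let qK : Q₁ →ₗ[A] LinearMap.ker q₀ := q₁.codRestrict _ fun x => hex.apply_apply_eq_zero x
  have hqK : Function.Surjective qK := by
    rintro ⟨x, hx⟩
    obtain ⟨y, hy⟩ := (hex x).1 hx
    exact ⟨y, Subtype.ext hy⟩
  obtain ⟨a₁, ha₁⟩ := Module.projective_lifting_property qK (aK ∘ₗ π₁) hqK
  obtain ⟨b₁, hb₁⟩ := Module.projective_lifting_property π₁ (bK ∘ₗ qK) hπ₁.2.1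
  have ha₁' : ∀ x, qK (a₁ x) = aK (π₁ x) := fun x => LinearMap.congr_fun ha₁ x
  have hba : Function.Injective (b₁ ∘ₗ a₁) := by
    refine hπ₁.injective_of_comp_eq _ (LinearMap.ext fun x => ?_)
    have h1 : π₁ (b₁ (a₁ x)) = bK (qK (a₁ x)) := LinearMap.congr_fun hb₁ (a₁ x)
    rw [LinearMap.comp_apply, LinearMap.comp_apply, h1, ha₁']
    exact Subtype.ext (ha' _)
  have ha_inj : Function.Injective a₁ := by
    rw [LinearMap.coe_comp] at hba
    exact hba.of_comp
  have hg := hom (a₁ ∘ₗ (LinearMap.ker π₁).subtype ∘ₗ g) (LinearMap.ext fun x => by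
    have h1 := congrArg Subtype.val (ha₁' (g x))
    rw [(g x).2, map_zero] at h1
    exact h1)
  ext x
  apply ha_inj
  rw [LinearMap.zero_apply, Submodule.coe_zero, map_zero]
  exact LinearMap.congr_fun hg x

lemma Module.Projective.of_isCompl {P : Type u} [AddCommGroup P] [Module A P]
    [Module.Projective A P] {U V : Submodule A P} (h : IsCompl U V) : Module.Projective A U :=
  .of_split U.subtype (U.projectionOnto V h) (U.projectionOnto_comp_subtype h)

/-- Finitely generated modules over an Artinian ring have projective covers. -/
lemma exists_isProjCover [IsArtinianRing A] (M : Type u) [AddCommGroup M] [Module A M]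
    [Module.Finite A M] :
    ∃ (P : Type u) (_ : AddCommGroup P) (_ : Module A P) (_ : Module.Finite A P)
      (π : P →ₗ[A] M), IsProjCover A π := by
  obtain ⟨n, π, hπ⟩ := Module.Finite.exists_fin' A M
  obtain ⟨L, ⟨hLproj, hLsurj⟩, hLmin⟩ := IsArtinian.set_has_minimal
    {L : Submodule A (Fin n → A) | Module.Projective A L ∧ Function.Surjective (π.domRestrict L)}
    ⟨⊤, .of_equiv' Submodule.topEquiv.symm, fun m => (hπ m).imp' (fun x => ⟨x, trivial⟩)
      fun _ h => h⟩
  refine ⟨L, inferInstance, inferInstance, inferInstance, π.domRestrict L, hLproj, hLsurj, ?_⟩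
  intro N hN
  have hNsurj : Function.Surjective (π.domRestrict L ∘ₗ N.subtype) := by
    intro m
    obtain ⟨l, rfl⟩ := hLsurj m
    obtain ⟨x, hx, y, hy, rfl⟩ := Submodule.mem_sup.1 (hN ▸ Submodule.mem_top : l ∈ N ⊔ _)
    refine ⟨⟨x, hx⟩, ?_⟩
    rw [map_add, LinearMap.mem_ker.1 hy, add_zero]
    rfl
  obtain ⟨h, hh⟩ := Module.projective_lifting_property _ (π.domRestrict L) hNsurj
  let f : Module.End A L := N.subtype ∘ₗ h
  have hf : ∀ x, π.domRestrict L (f x) = π.domRestrict L x := fun x => LinearMap.congr_fun hh x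
  have hfn : ∀ (n : ℕ) x, π.domRestrict L ((f ^ n) x) = π.domRestrict L x := by
    intro n
    induction n with
    | zero => intro x; rfl
    | succ n ih => intro x; rw [pow_succ, Module.End.mul_apply, ih, hf]
  obtain ⟨m, hm, hm1⟩ := (f.eventually_isCompl_ker_pow_range_pow.and
    (Filter.eventually_ge_atTop 1)).exists
  have hle : LinearMap.range (f ^ m) ≤ N := by
    rintro _ ⟨x, rfl⟩
    obtain ⟨m, rfl⟩ := Nat.exists_eq_add_of_le' hm1
    rw [pow_succ', Module.End.mul_apply]
    exact (h _).2
  have hproj : Module.Projective A ((LinearMap.range (f ^ m)).map L.subtype) :=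
    have := Module.Projective.of_isCompl hm.symm
    .of_equiv' (Submodule.equivMapOfInjective _ L.injective_subtype _)
  have hmap := hLmin ((LinearMap.range (f ^ m)).map L.subtype) ⟨hproj, fun y => by
    obtain ⟨x, rfl⟩ := hLsurj y
    exact ⟨⟨_, Submodule.mem_map_of_mem ⟨x, rfl⟩⟩, hfn m x⟩⟩
  refine eq_top_iff.2 (le_trans (fun x _ => ?_) hle)
  have hx : (x : Fin n → A) ∈ (LinearMap.range (f ^ m)).map L.subtype :=
    not_lt_iff_le_imp_ge.1 hmap (Submodule.map_subtype_le _ _) x.2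
  obtain ⟨y, hy, hyx⟩ := hx
  rwa [← Subtype.ext hyx]

end ProjectiveCovers

section Induced

variable {R S : Type u} [Ring R] [Ring S] {ι : R →+* S}
  {M : Type u} [AddCommGroup M] [Module R M]
  {N : Type u} [AddCommGroup N] [Module S N] {j : M →+ N}

lemma IsInducedMod.hom_ext (h : IsInducedMod ι M N j) {X : Type u} [AddCommGroup X] [Module S X]
    {g g' : N →ₗ[S] X} (hg : ∀ m, g (j m) = g' (j m)) : g = g' :=
  (h.2 X (g'.toAddMonoidHom.comp j) fun r m => by simp [h.1]).unique hg fun _ => rfl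

lemma IsInducedMod.projective (h : IsInducedMod ι M N j) [Module.Projective R M] :
    Module.Projective S N := by
  refine Module.Projective.of_lifting_property fun {X Y} _ _ _ _ f g hf => ?_
  let _ := Module.compHom X ι
  let _ := Module.compHom Y ι
  let f' : X →ₗ[R] Y := { f with map_smul' := fun r x => f.map_smul (ι r) x }
  let g' : M →ₗ[R] Y :=
    { g.toAddMonoidHom.comp j with
      map_smul' := fun r m => (congrArg g (h.1 r m)).trans (g.map_smul (ι r) (j m)) }
  obtain ⟨l, hl⟩ := Module.projective_lifting_property f' g' hf
  obtain ⟨l', hl', -⟩ := h.2 X l.toAddMonoidHom fun r m => l.map_smul r m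
  refine ⟨l', h.hom_ext fun m => ?_⟩
  rw [LinearMap.comp_apply, hl']
  exact LinearMap.congr_fun hl m

/-- Two modules induced from the same module are isomorphic. -/
lemma IsInducedMod.exists_equiv (h : IsInducedMod ι M N j) {N' : Type u} [AddCommGroup N']
    [Module S N'] {j' : M →+ N'} (h' : IsInducedMod ι M N' j') : Nonempty (N ≃ₗ[S] N') := by
  obtain ⟨a, ha, -⟩ := h.2 N' j' h'.1
  obtain ⟨b, hb, -⟩ := h'.2 N j h.1
  exact ⟨LinearEquiv.ofLinearMap a b (h'.hom_ext fun m => by simp [ha, hb])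
    (h.hom_ext fun m => by simp [ha, hb])⟩

end Induced

section Coinduced

variable {R S : Type u} [Ring R] [Ring S]

/-- The additive group `Hom_R(S, V)`, where `R` acts on `S` by left multiplication via `ι`. -/
def coindSubgroup (ι : R →+* S) (V : Type u) [AddCommGroup V] [Module R V] :
    AddSubgroup (S →+ V) where
  carrier := {f | ∀ r s, f (ι r * s) = r • f s}
  add_mem' := fun hf hg r s => by simp [hf r s, hg r s]
  zero_mem' := fun r s => by simp
  neg_mem' := fun hf r s => by simp [hf r s]

/-- The coinduced module `Hom_R(S, V)`. -/
def Coind (ι : R →+* S) (V : Type u) [AddCommGroup V] [Module R V] : Type u :=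
  coindSubgroup ι V

namespace Coind

variable {ι : R →+* S} {V W : Type u} [AddCommGroup V] [Module R V] [AddCommGroup W] [Module R W]

instance : AddCommGroup (Coind ι V) := inferInstanceAs (AddCommGroup (coindSubgroup ι V))

/-- Evaluation of an element of the coinduced module at `s`. -/
def eval (s : S) : Coind ι V →+ V where
  toFun f := f.1 s
  map_zero' := rfl
  map_add' _ _ := rfl

@[ext]
lemma ext {f g : Coind ι V} (h : ∀ s, eval s f = eval s g) : f = g :=
  Subtype.ext (AddMonoidHom.ext h)

lemma eval_mul (r : R) (s : S) (f : Coind ι V) : eval (ι r * s) f = r • eval s f := f.2 r s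

lemma eval_add (s t : S) (f : Coind ι V) : eval (s + t) f = eval s f + eval t f := map_add f.1 s t

lemma eval_zero (f : Coind ι V) : eval 0 f = 0 := map_zero f.1

lemma eval_sum {I : Type*} (t : Finset I) (s : I → S) (f : Coind ι V) :
    eval (∑ i ∈ t, s i) f = ∑ i ∈ t, eval (s i) f := map_sum f.1 s t

instance : SMul S (Coind ι V) where
  smul s f := ⟨f.1.comp (AddMonoidHom.mulRight s), fun r t => by
    simpa [mul_assoc] using f.2 r (t * s)⟩

lemma eval_smul (s t : S) (f : Coind ι V) : eval s (t • f) = eval (s * t) f := rfl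

instance : Module S (Coind ι V) where
  one_smul f := ext fun s => by rw [eval_smul, mul_one]
  mul_smul a b f := ext fun s => by rw [eval_smul, eval_smul, eval_smul, mul_assoc]
  smul_zero a := rfl
  smul_add a f g := ext fun s => by simp only [eval_smul, map_add]
  add_smul a b f := ext fun s => by simp only [eval_smul, map_add, mul_add, eval_add]
  zero_smul f := ext fun s => by rw [eval_smul, mul_zero, eval_zero, map_zero]

/-- Functoriality of coinduction. -/
def map (ι : R →+* S) (f : V →ₗ[R] W) : Coind ι V →ₗ[S] Coind ι W where
  toFun g := ⟨f.toAddMonoidHom.comp g.1, fun r s => by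
    simpa using congrArg f (g.2 r s)⟩
  map_add' g h := ext fun s => map_add f _ _
  map_smul' s g := rfl

lemma eval_map (f : V →ₗ[R] W) (g : Coind ι V) (s : S) : eval s (map ι f g) = f (eval s g) := rfl

end Coind

/-- A Frobenius system for a ring extension `ι : R → S`: a bimodule map `E : S → R` together
with dual bases. -/
structure FrobeniusSystem (ι : R →+* S) (I : Type*) [Fintype I] where
  /-- The Frobenius homomorphism. -/
  E : S →+ R
  E_mul_left : ∀ r s, E (ι r * s) = r * E s
  E_mul_right : ∀ r s, E (s * ι r) = E s * r
  /-- The first dual basis. -/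
  x : I → S
  /-- The second dual basis. -/
  y : I → S
  sum_left : ∀ s, ∑ i, y i * ι (E (x i * s)) = s
  sum_right : ∀ s, ∑ i, ι (E (s * y i)) * x i = s

namespace FrobeniusSystem

variable {ι : R →+* S} {I : Type*} [Fintype I] (F : FrobeniusSystem ι I)
  {V W : Type u} [AddCommGroup V] [Module R V] [AddCommGroup W] [Module R W]

/-- The canonical map from a module to its coinduced module over a Frobenius extension. -/
def toCoind : V →+ Coind ι V where
  toFun v := ⟨((AddMonoidHom.smul : R →+ V →+ V).flip v).comp F.E, fun r s => by
    simp [F.E_mul_left, mul_smul]⟩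
  map_zero' := Coind.ext fun s => smul_zero (F.E s)
  map_add' v w := Coind.ext fun s => smul_add (F.E s) v w

lemma eval_toCoind (s : S) (v : V) : Coind.eval s (F.toCoind v : Coind ι V) = F.E s • v := rfl

lemma map_toCoind (f : V →ₗ[R] W) (v : V) :
    Coind.map ι f (F.toCoind v) = F.toCoind (f v) :=
  Coind.ext fun s => by rw [Coind.eval_map, eval_toCoind, eval_toCoind, map_smul]

lemma sum_smul_toCoind (f : Coind ι V) :
    ∑ i, F.y i • (F.toCoind (Coind.eval (F.x i) f) : Coind ι V) = f := by
  ext s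
  simp only [map_sum, Coind.eval_smul, eval_toCoind, ← Coind.eval_mul]
  rw [← Coind.eval_sum, F.sum_right]

/-- Over a Frobenius extension, the coinduced module is induced. -/
lemma isInducedMod_coind : IsInducedMod ι V (Coind ι V) F.toCoind := by
  refine ⟨fun r v => Coind.ext fun s => ?_, fun X _ _ f hf => ?_⟩
  · rw [eval_toCoind, Coind.eval_smul, eval_toCoind, F.E_mul_right, mul_smul]
  let g : Coind ι V →+ X :=
    ∑ i, (DistribSMul.toAddMonoidHom X (F.y i)).comp (f.comp (Coind.eval (F.x i)))
  have hg_apply : ∀ u, g u = ∑ i, F.y i • f (Coind.eval (F.x i) u) := fun u => by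
    simp [g, AddMonoidHom.finsetSum_apply]
  have hg : ∀ (s : S) v, g (s • F.toCoind v) = s • f v := fun s v => by
    simp only [hg_apply, Coind.eval_smul, eval_toCoind, hf, smul_smul]
    rw [← Finset.sum_smul, F.sum_left]
  have hg_smul : ∀ (s : S) u, g (s • u) = s • g u := fun s u => by
    rw [← F.sum_smul_toCoind u]
    simp only [Finset.smul_sum, map_sum, smul_smul, hg]
  refine ⟨{ g with map_smul' := hg_smul }, fun v => ?_, fun g' hg' => LinearMap.ext fun u => ?_⟩
  · simpa using hg 1 v
  · rw [← F.sum_smul_toCoind u]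
    simp only [map_sum, map_smul, hg']
    exact Finset.sum_congr rfl fun i _ => congrArg (F.y i • ·) (by simpa using (hg 1 _).symm)

lemma map_surjective (F : FrobeniusSystem ι I) {f : V →ₗ[R] W} (hf : Function.Surjective f) :
    Function.Surjective (Coind.map ι f) := by
  intro u
  choose v hv using fun i => hf (Coind.eval (F.x i) u)
  refine ⟨∑ i, F.y i • F.toCoind (v i), ?_⟩
  simp only [map_sum, map_smul, map_toCoind, hv, F.sum_smul_toCoind]

end FrobeniusSystem

end Coinduced

section GroupAlgebra

variable (k : Type u) [Field k] (Gt : Type u) [Group Gt] (G : Subgroup Gt)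

/-- The projection `kG̃ → kG` which forgets the group elements outside `G`. -/
noncomputable def restrictHom : MonoidAlgebra k Gt →+ MonoidAlgebra k ↥G :=
  MonoidAlgebra.comapDomainAddMonoidHom (G.subtype : ↥G → Gt) G.subtype_injective

variable {k Gt G}

lemma inclRingHom_single (h : ↥G) (a : k) :
    inclRingHom k Gt G (.single h a) = .single (h : Gt) a :=
  MonoidAlgebra.mapDomain_single

lemma restrictHom_single_coe (h : ↥G) (a : k) :
    restrictHom k Gt G (.single (h : Gt) a) = .single h a :=
  MonoidAlgebra.comapDomain_single_map _ G.subtype_injective _ _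

lemma restrictHom_single_of_notMem {x : Gt} (hx : x ∉ G) (a : k) :
    restrictHom k Gt G (.single x a) = 0 :=
  MonoidAlgebra.comapDomain_single_of_not_mem_range (by simpa using hx)
    G.subtype_injective

open Classical in
lemma inclRingHom_restrictHom_single (x : Gt) (a : k) :
    inclRingHom k Gt G (restrictHom k Gt G (.single x a)) =
      if x ∈ G then .single x a else 0 := by
  split_ifs with hx
  · lift x to G using hx
    rw [restrictHom_single_coe, inclRingHom_single]
  · rw [restrictHom_single_of_notMem hx, map_zero]

lemma restrictHom_inclRingHom_mul (r : MonoidAlgebra k ↥G) (s : MonoidAlgebra k Gt) :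
    restrictHom k Gt G (inclRingHom k Gt G r * s) = r * restrictHom k Gt G s := by
  induction r using MonoidAlgebra.induction_linear with
  | zero => simp
  | add r r' h h' => simp only [map_add, add_mul, h, h']
  | single h a =>
    induction s using MonoidAlgebra.induction_linear with
    | zero => simp
    | add s s' h h' => simp only [map_add, mul_add, h, h']
    | single x b =>
      rw [inclRingHom_single, MonoidAlgebra.single_mul_single]
      by_cases hx : x ∈ G
      · lift x to G using hx
        rw [restrictHom_single_coe, MonoidAlgebra.single_mul_single, ← restrictHom_single_coe,
          Subgroup.coe_mul]
      · rw [restrictHom_single_of_notMem hx, restrictHom_single_of_notMem, mul_zero]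
        rwa [Subgroup.mul_mem_cancel_left _ h.2]

lemma restrictHom_mul_inclRingHom (s : MonoidAlgebra k Gt) (r : MonoidAlgebra k ↥G) :
    restrictHom k Gt G (s * inclRingHom k Gt G r) = restrictHom k Gt G s * r := by
  induction r using MonoidAlgebra.induction_linear with
  | zero => simp
  | add r r' h h' => simp only [map_add, mul_add, h, h']
  | single h a =>
    induction s using MonoidAlgebra.induction_linear with
    | zero => simp
    | add s s' h h' => simp only [map_add, add_mul, h, h']
    | single x b =>
      rw [inclRingHom_single, MonoidAlgebra.single_mul_single]
      by_cases hx : x ∈ G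
      · lift x to G using hx
        rw [restrictHom_single_coe, MonoidAlgebra.single_mul_single, ← restrictHom_single_coe,
          Subgroup.coe_mul]
      · rw [restrictHom_single_of_notMem hx, restrictHom_single_of_notMem, zero_mul]
        rwa [Subgroup.mul_mem_cancel_right _ h.2]

lemma Coind.ext_single {V : Type u} [AddCommGroup V] [Module (MonoidAlgebra k ↥G) V]
    {f g : Coind (inclRingHom k Gt G) V}
    (h : ∀ x : Gt, eval (.single x 1) f = eval (.single x 1) g) : f = g := by
  ext s
  induction s using MonoidAlgebra.induction_linear with
  | zero => rw [eval_zero, eval_zero]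
  | add s t hs ht => rw [eval_add, eval_add, hs, ht]
  | single x a =>
    have hx : (.single x a : MonoidAlgebra k Gt) =
        inclRingHom k Gt G (.single 1 a) * .single x 1 := by
      simp [inclRingHom_single, MonoidAlgebra.single_mul_single]
    rw [hx, eval_mul, eval_mul, h]

variable [G.Normal]

lemma conjRingHom_single (x : Gt) (h : ↥G) (a : k) :
    conjRingHom k Gt G x (.single h a) = .single (MulAut.conjNormal x h) a :=
  MonoidAlgebra.mapDomain_single

variable (k Gt G) in
/-- The Frobenius system of `kG ⊆ kG̃` given by coset representatives. -/
noncomputable def groupFrobeniusSystem [Fintype (Gt ⧸ G)] :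
    FrobeniusSystem (inclRingHom k Gt G) (Gt ⧸ G) where
  E := restrictHom k Gt G
  E_mul_left := restrictHom_inclRingHom_mul
  E_mul_right r s := restrictHom_mul_inclRingHom s r
  x c := .single c.out 1
  y c := .single c.out⁻¹ 1
  sum_left s := by
    classical
    induction s using MonoidAlgebra.induction_linear with
    | zero => simp
    | add s s' h h' => simp only [map_add, mul_add, Finset.sum_add_distrib, h, h']
    | single z a =>
      have h : ∀ c : Gt ⧸ G, c.out * z ∈ G ↔ c = (z : Gt ⧸ G)⁻¹ := fun c => by
        rw [← QuotientGroup.eq_one_iff, QuotientGroup.mk_mul, QuotientGroup.out_eq',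
          mul_eq_one_iff_eq_inv]
      simp [MonoidAlgebra.single_mul_single, inclRingHom_restrictHom_single, h]
  sum_right s := by
    classical
    induction s using MonoidAlgebra.induction_linear with
    | zero => simp
    | add s s' h h' => simp only [map_add, add_mul, Finset.sum_add_distrib, h, h']
    | single z a =>
      have h : ∀ c : Gt ⧸ G, z * c.out⁻¹ ∈ G ↔ c = (z : Gt ⧸ G) := fun c => by
        rw [← QuotientGroup.eq_one_iff, QuotientGroup.mk_mul, QuotientGroup.mk_inv,
          QuotientGroup.out_eq', mul_inv_eq_one, eq_comm]
      simp [MonoidAlgebra.single_mul_single, inclRingHom_restrictHom_single, h]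

lemma single_mul_inclRingHom (x : Gt) (r : MonoidAlgebra k ↥G) :
    .single x 1 * inclRingHom k Gt G r =
      inclRingHom k Gt G (conjRingHom k Gt G x r) * .single x 1 := by
  induction r using MonoidAlgebra.induction_linear with
  | zero => simp
  | add r r' h h' => simp only [map_add, add_mul, mul_add, h, h']
  | single h a =>
    simp [conjRingHom_single, inclRingHom_single, MonoidAlgebra.single_mul_single]

lemma conjRingHom_conjRingHom_inv (x : Gt) (r : MonoidAlgebra k ↥G) :
    conjRingHom k Gt G x (conjRingHom k Gt G x⁻¹ r) = r := by
  induction r using MonoidAlgebra.induction_linear with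
  | zero => simp
  | add r r' h h' => simp only [map_add, h, h']
  | single h a => rw [conjRingHom_single, conjRingHom_single, map_inv, MulAut.apply_inv_self]

/-- A Mackey-type vanishing criterion for maps from the induced module of a conjugation stable
module to a coinduced module. -/
lemma IsInducedMod.hom_coind_eq_zero {M N V W : Type u} [AddCommGroup M]
    [Module (MonoidAlgebra k ↥G) M] [AddCommGroup N] [Module (MonoidAlgebra k Gt) N]
    [AddCommGroup V] [Module (MonoidAlgebra k ↥G) V] [AddCommGroup W]
    [Module (MonoidAlgebra k ↥G) W] {j : M →+ N} (hN : IsInducedMod (inclRingHom k Gt G) M N j)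
    (hM : ∀ x : Gt, IsConjStable k Gt G x M) (q : V →ₗ[MonoidAlgebra k ↥G] W)
    (hq : ∀ f : M →ₗ[MonoidAlgebra k ↥G] V, q ∘ₗ f = 0 → f = 0)
    (g : N →ₗ[MonoidAlgebra k Gt] Coind (inclRingHom k Gt G) V)
    (hg : Coind.map (inclRingHom k Gt G) q ∘ₗ g = 0) : g = 0 := by
  refine hN.hom_ext fun m => Coind.ext_single fun x => ?_
  obtain ⟨φ, hφ⟩ := hM x
  let f : M →ₗ[MonoidAlgebra k ↥G] V :=
    { toFun := fun m => Coind.eval (.single x 1) (g (j (φ m)))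
      map_add' := fun m m' => by simp only [map_add]
      map_smul' := fun r m => by
        rw [← conjRingHom_conjRingHom_inv x r, hφ, hN.1, map_smul, Coind.eval_smul,
          single_mul_inclRingHom, Coind.eval_mul]
        rfl }
  have hf : f = 0 := hq f <| LinearMap.ext fun m => by
    have := congrArg (Coind.eval (.single x 1)) (LinearMap.congr_fun hg (j (φ m)))
    exact this.trans (map_zero _)
  have := LinearMap.congr_fun hf (φ.symm m)
  simpa [f] using this

end GroupAlgebra

/-- If `M` is τ-rigid and `x M ≅ M` for all `x ∈ G̃`, then
`Ind_G^{G̃} M` is a τ-rigid `kG̃`-module. -/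
theorem isTauRigid_induced_of_isTauRigid
    (k : Type u) [Field k] [IsAlgClosed k] (p : ℕ) (hp : 0 < p) [CharP k p]
    (Gt : Type u) [Group Gt] [Fintype Gt] (G : Subgroup Gt) [G.Normal]
    (M : Type u) [AddCommGroup M] [Module (MonoidAlgebra k ↥G) M]
    [Module.Finite (MonoidAlgebra k ↥G) M]
    (hrig : IsTauRigid (MonoidAlgebra k ↥G) M)
    (hM : ∀ x : Gt, IsConjStable k Gt G x M)
    (N : Type u) [AddCommGroup N] [Module (MonoidAlgebra k Gt) N]
    (jM : M →+ N) (hN : IsInducedMod (inclRingHom k Gt G) M N jM) :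
    IsTauRigid (MonoidAlgebra k Gt) N := by
  have := Fintype.ofFinite (Gt ⧸ G)
  have : IsArtinianRing (MonoidAlgebra k ↥G) := IsArtinianRing.of_finite k _
  let F := groupFrobeniusSystem k Gt G
  obtain ⟨P₀, _, _, _, π₀, hπ₀⟩ := exists_isProjCover (A := MonoidAlgebra k ↥G) M
  obtain ⟨P₁, _, _, _, π₁, hπ₁⟩ :=
    exists_isProjCover (A := MonoidAlgebra k ↥G) (LinearMap.ker π₀)
  have := hπ₀.1
  have := hπ₁.1
  have : Module.Projective (MonoidAlgebra k Gt) (Coind (inclRingHom k Gt G) P₀) :=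
    F.isInducedMod_coind.projective
  have : Module.Projective (MonoidAlgebra k Gt) (Coind (inclRingHom k Gt G) P₁) :=
    F.isInducedMod_coind.projective
  obtain ⟨e⟩ := F.isInducedMod_coind.exists_equiv hN
  let q₁ := (LinearMap.ker π₀).subtype ∘ₗ π₁
  refine isTauRigid_of_presentation (Coind.map _ q₁) (e.toLinearMap ∘ₗ Coind.map _ π₀)
    (e.surjective.comp (F.map_surjective hπ₀.2.1)) (fun u => ⟨fun hu => ?_, ?_⟩)
    (hN.hom_coind_eq_zero hM q₁ fun f hf => ?_)
  · have hu' : Coind.map _ π₀ u = 0 := e.map_eq_zero_iff.1 hu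
    let u' : Coind (inclRingHom k Gt G) (LinearMap.ker π₀) :=
      ⟨{toFun := fun s => ⟨Coind.eval s u, congrArg (Coind.eval s) hu'⟩
        map_zero' := Subtype.ext (Coind.eval_zero u)
        map_add' := fun s t => Subtype.ext (Coind.eval_add s t u) },
        fun r s => Subtype.ext (Coind.eval_mul r s u)⟩
    obtain ⟨v, hv⟩ := F.map_surjective hπ₁.2.1 u'
    exact ⟨v, congrArg (Coind.map _ (LinearMap.ker π₀).subtype) hv⟩
  · rintro ⟨v, rfl⟩
    refine e.map_eq_zero_iff.2 (Coind.ext fun s => ?_)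
    exact (π₁ (Coind.eval s v)).2
  · have hf' : ∀ m, f m ∈ LinearMap.ker π₁ := fun m => Subtype.ext (LinearMap.congr_fun hf m)
    have := hrig P₀ π₀ hπ₀ P₁ π₁ hπ₁ (f.codRestrict _ hf')
    exact LinearMap.ext fun m => congrArg Subtype.val (LinearMap.congr_fun this m)
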